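/- arXiv:2110.13949 — 3 statements merged into one kernel-verified Lean document; each statement's English description precedes it below -/
import Mathlib

section
/- Let ε be an edge-weight function and υ a vertex-weight function on a finite set V with n = |V|, let v₀ ∈ V, and let υ' be a vertex-weight function with 0 < υ'(v₀) < υ(v₀) and υ'(x) = υ(x) for all x ≠ v₀. Let λ_1 ≤ … ≤ λ_n and μ_1 ≤ … ≤ μ_n denote the weighted Laplacian eigenvalues of (ε,υ) and (ε,υ'), respectively. Then λ_i ≤ μ_i for all 1 ≤ i ≤ n, and μ_i ≤ λ_{i+1} for all 1 ≤ i ≤ n−1. -/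
open Matrix Polynomial
open scoped Classical

/-- The combinatorial Laplacian of an edge-weight function. -/
noncomputable def lapMat {V : Type} [Fintype V] [DecidableEq V] (ε : V → V → ℝ) :
    Matrix V V ℝ :=
  Matrix.diagonal (fun v => ∑ u, ε v u) - Matrix.of ε

/-- The weighted Laplacian `W(υ)⁻¹ · L(ε)`, whose eigenvalues coincide with those of
the symmetric matrix `W(υ)^{-1/2} L(ε) W(υ)^{-1/2}`. -/
noncomputable def wlap {V : Type} [Fintype V] [DecidableEq V]
    (ε : V → V → ℝ) (υ : V → ℝ) : Matrix V V ℝ :=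
  Matrix.diagonal (fun v => (υ v)⁻¹) * lapMat ε

/-- A real symmetric matrix is diagonal in orthonormal coordinates. -/
lemma Matrix.IsHermitian.exists_diagonalizing_coords {V : Type} [Fintype V] [DecidableEq V]
    {A : Matrix V V ℝ} (hA : A.IsHermitian) :
    ∃ Q : Matrix V V ℝ, (∀ x, x ⬝ᵥ x = ∑ j, (Q *ᵥ x) j ^ 2) ∧
      ∀ x, x ⬝ᵥ (A *ᵥ x) = ∑ j, hA.eigenvalues j * (Q *ᵥ x) j ^ 2 := by
  set U : Matrix V V ℝ := (hA.eigenvectorUnitary).1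
  have hU : U * Uᵀ = 1 := by
    simpa [star_eq_conjTranspose] using Unitary.coe_mul_star_self hA.eigenvectorUnitary
  have hAU : A = U * diagonal hA.eigenvalues * Uᵀ := by
    have h := hA.spectral_theorem
    rw [Unitary.conjStarAlgAut_apply] at h
    simpa [star_eq_conjTranspose, Function.comp_def] using h
  have key : ∀ D : Matrix V V ℝ, ∀ x : V → ℝ,
      x ⬝ᵥ ((U * D * Uᵀ) *ᵥ x) = (Uᵀ *ᵥ x) ⬝ᵥ (D *ᵥ (Uᵀ *ᵥ x)) := by
    intro D x
    rw [← mulVec_mulVec, ← mulVec_mulVec, dotProduct_mulVec, ← mulVec_transpose]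
  refine ⟨Uᵀ, fun x => ?_, fun x => ?_⟩
  · have h := key 1 x
    rw [mul_one, hU, one_mulVec, one_mulVec] at h
    rw [h]
    simp [dotProduct, sq]
  · conv_lhs => rw [hAU]
    rw [key]
    refine Finset.sum_congr rfl fun j _ => ?_
    rw [mulVec_diagonal]
    ring

/-- Two families of roots of the same monic polynomial agree up to a bijection. -/
lemma exists_equiv_of_prod_X_sub_C_eq {ι κ : Type} [Fintype ι] [Fintype κ]
    {f : ι → ℝ} {g : κ → ℝ} (h : ∏ i, (X - C (f i)) = ∏ k, (X - C (g k))) :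
    ∃ e : ι ≃ κ, ∀ i, f i = g (e i) := by
  have hroots : Finset.univ.val.map f = Finset.univ.val.map g := by
    have h' := congrArg Polynomial.roots h
    have aux : ∀ {α : Type} [Fintype α] (p : α → ℝ),
        (∏ a, (X - C (p a))).roots = Finset.univ.val.map p := by
      intro α _ p
      have := roots_multiset_prod_X_sub_C (Finset.univ.val.map p)
      rwa [Multiset.map_map] at this
    rwa [aux, aux] at h'
  have hcard : ∀ a : ℝ, Fintype.card {i // f i = a} = Fintype.card {k // g k = a} := by
    intro a
    have := congrArg (Multiset.count a) hroots
    rw [Multiset.count_map, Multiset.count_map] at this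
    simp only [Fintype.card_subtype]
    simpa [Finset.card_def, Finset.filter_val, eq_comm] using this
  refine ⟨Equiv.ofFiberEquiv (f := f) (g := g) fun a => Fintype.equivOfCardEq (hcard a),
    fun i => ?_⟩
  exact (Equiv.ofFiberEquiv_map _ i).symm

/-- Coordinates simultaneously diagonalizing a symmetric form and a weighted sum of squares. -/
lemma exists_weighted_diagonalizing_coords {V : Type} [Fintype V] [DecidableEq V]
    {L : Matrix V V ℝ} (hL : L.IsHermitian) {υ : V → ℝ} (hυ : ∀ v, 0 < υ v)
    {ι : Type} [Fintype ι] {lam : ι → ℝ}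
    (hlam : (diagonal (fun v => (υ v)⁻¹) * L).charpoly = ∏ i, (X - C (lam i))) :
    ∃ Q : Matrix ι V ℝ, (∀ x, ∑ v, υ v * x v ^ 2 = ∑ j, (Q *ᵥ x) j ^ 2) ∧
      ∀ x, x ⬝ᵥ (L *ᵥ x) = ∑ j, lam j * (Q *ᵥ x) j ^ 2 := by
  set D : Matrix V V ℝ := diagonal fun v => (√(υ v))⁻¹
  set S : Matrix V V ℝ := diagonal fun v => √(υ v)
  have hs : ∀ v, √(υ v) ≠ 0 := fun v => (Real.sqrt_pos.2 (hυ v)).ne'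
  have hDS : D * S = 1 := by
    simp [D, S, hs]
  have hDT : Dᴴ = D := by simp [D]
  have hA : (D * L * D).IsHermitian := by
    have h := isHermitian_mul_mul_conjTranspose D hL
    rwa [hDT] at h
  have hchar : (D * L * D).charpoly = ∏ i, (X - C (lam i)) := by
    rw [← hlam, mul_assoc, charpoly_mul_comm, mul_assoc, charpoly_mul_comm]
    congr 2
    simp only [D, diagonal_mul_diagonal]
    congr 1
    funext v
    rw [← mul_inv, Real.mul_self_sqrt (hυ v).le]
  obtain ⟨Q, hQ, hQA⟩ := hA.exists_diagonalizing_coords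
  obtain ⟨e, he⟩ := exists_equiv_of_prod_X_sub_C_eq (hchar.symm.trans hA.charpoly_eq)
  have hSx : ∀ x : V → ℝ, D *ᵥ (S *ᵥ x) = x := fun x => by
    rw [mulVec_mulVec, hDS, one_mulVec]
  refine ⟨(Q * S).submatrix e id, fun x => ?_, fun x => ?_⟩
  · have h := hQ (S *ᵥ x)
    rw [mulVec_mulVec, ← e.sum_comp] at h
    refine Eq.trans ?_ h
    refine Finset.sum_congr rfl fun v _ => ?_
    rw [mulVec_diagonal]
    nlinarith [Real.mul_self_sqrt (hυ v).le]
  · have h := hQA (S *ᵥ x)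
    rw [← mulVec_mulVec, ← mulVec_mulVec, hSx, dotProduct_mulVec,
      ← mulVec_transpose, ← conjTranspose_eq_transpose_of_trivial, hDT, hSx, mulVec_mulVec,
      ← e.sum_comp] at h
    rw [h]
    refine Finset.sum_congr rfl fun j _ => ?_
    rw [he]
    rfl

lemma lapMat_isHermitian {V : Type} [Fintype V] [DecidableEq V] {ε : V → V → ℝ}
    (hsym : ∀ u v, ε u v = ε v u) : (lapMat ε).IsHermitian := by
  refine (isHermitian_diagonal _).sub ?_
  ext u v
  simp [hsym u v]

/-- The Laplacian of a nonnegative symmetric edge-weight function is positive semidefinite. -/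
lemma dotProduct_lapMat_mulVec_nonneg {V : Type} [Fintype V] [DecidableEq V] {ε : V → V → ℝ}
    (hsym : ∀ u v, ε u v = ε v u) (hnonneg : ∀ u v, 0 ≤ ε u v) (x : V → ℝ) :
    0 ≤ x ⬝ᵥ (lapMat ε *ᵥ x) := by
  have h1 : x ⬝ᵥ (lapMat ε *ᵥ x) = ∑ u, ∑ v, ε u v * (x u ^ 2 - x u * x v) := by
    simp only [lapMat, sub_mulVec, dotProduct, Pi.sub_apply, mulVec_diagonal]
    refine Finset.sum_congr rfl fun u _ => ?_
    simp only [mulVec, dotProduct, of_apply, mul_sub, Finset.sum_sub_distrib, Finset.mul_sum,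
      Finset.sum_mul]
    congr 1 <;> refine Finset.sum_congr rfl fun v _ => ?_ <;> ring
  have h2 : x ⬝ᵥ (lapMat ε *ᵥ x) = ∑ u, ∑ v, ε u v * (x v ^ 2 - x u * x v) := by
    rw [h1, Finset.sum_comm]
    refine Finset.sum_congr rfl fun u _ => Finset.sum_congr rfl fun v _ => ?_
    rw [hsym v u]
    ring
  have h3 : 2 * (x ⬝ᵥ (lapMat ε *ᵥ x)) = ∑ u, ∑ v, ε u v * (x u - x v) ^ 2 := by
    rw [two_mul]
    nth_rewrite 1 [h1]
    rw [h2]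
    simp only [← Finset.sum_add_distrib]
    refine Finset.sum_congr rfl fun u _ => Finset.sum_congr rfl fun v _ => ?_
    ring
  have h4 : 0 ≤ ∑ u, ∑ v, ε u v * (x u - x v) ^ 2 :=
    Finset.sum_nonneg fun u _ => Finset.sum_nonneg fun v _ =>
      mul_nonneg (hnonneg u v) (sq_nonneg _)
  linarith

/-- A homogeneous linear system with fewer equations than unknowns has a nonzero solution. -/
lemma Matrix.exists_ne_zero_mulVec_eq_zero_of_card_lt {ι V : Type} [Fintype ι] [Fintype V]
    (M : Matrix ι V ℝ) (h : Fintype.card ι < Fintype.card V) :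
    ∃ x ≠ 0, M *ᵥ x = 0 := by
  have hker : LinearMap.ker M.mulVecLin ≠ ⊥ :=
    LinearMap.ker_ne_bot_of_finrank_lt (by simpa using h)
  obtain ⟨x, hx, hx0⟩ := Submodule.exists_mem_ne_zero_of_ne_bot hker
  exact ⟨x, hx0, by simpa using hx⟩

lemma weighted_sum_sq_pos {V : Type} [Fintype V] {υ : V → ℝ} (hυ : ∀ v, 0 < υ v)
    {x : V → ℝ} (hx : x ≠ 0) : 0 < ∑ v, υ v * x v ^ 2 := by
  obtain ⟨v, hv⟩ := Function.ne_iff.1 hx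
  exact Finset.sum_pos' (fun u _ => mul_nonneg (hυ u).le (sq_nonneg _))
    ⟨v, Finset.mem_univ v, mul_pos (hυ v) (sq_pos_of_ne_zero hv)⟩

lemma sum_mul_sq_le_of_forall_gt {n : ℕ} {lam : Fin n → ℝ} (hlam : Monotone lam) {i : Fin n}
    {c : Fin n → ℝ} (hc : ∀ j, i < j → c j = 0) :
    ∑ j, lam j * c j ^ 2 ≤ lam i * ∑ j, c j ^ 2 := by
  rw [Finset.mul_sum]
  refine Finset.sum_le_sum fun j _ => ?_
  rcases le_or_gt j i with h | h
  · exact mul_le_mul_of_nonneg_right (hlam h) (sq_nonneg _)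
  · simp [hc j h]

lemma le_sum_mul_sq_of_forall_lt {n : ℕ} {lam : Fin n → ℝ} (hlam : Monotone lam) {i : Fin n}
    {c : Fin n → ℝ} (hc : ∀ j, j < i → c j = 0) :
    lam i * ∑ j, c j ^ 2 ≤ ∑ j, lam j * c j ^ 2 := by
  rw [Finset.mul_sum]
  refine Finset.sum_le_sum fun j _ => ?_
  rcases le_or_gt i j with h | h
  · exact mul_le_mul_of_nonneg_right (hlam h) (sq_nonneg _)
  · simp [hc j h]

/-- **Interlacing under decreasing a vertex weight**: if `υ'` is obtained from `υ` by
decreasing the weight of a single vertex, then `λ₁ ≤ μ₁ ≤ λ₂ ≤ … ≤ λₙ ≤ μₙ`. -/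
theorem interlacing_vertex_weight_decrease
    {V : Type} [Fintype V] [DecidableEq V]
    (ε : V → V → ℝ) (hsym : ∀ u v, ε u v = ε v u)
    (hnonneg : ∀ u v, 0 ≤ ε u v) (hdiag : ∀ v, ε v v = 0)
    (υ : V → ℝ) (hυ : ∀ v, 0 < υ v)
    (n : ℕ) (hn : n = Fintype.card V)
    (v₀ : V) (υ' : V → ℝ)
    (hυ'pos : 0 < υ' v₀) (hυ'lt : υ' v₀ < υ v₀)
    (hυ'eq : ∀ x, x ≠ v₀ → υ' x = υ x)
    (lam mu : Fin n → ℝ) (hlamMono : Monotone lam) (hmuMono : Monotone mu)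
    (hlam : (wlap ε υ).charpoly = ∏ i, (X - C (lam i)))
    (hmu : (wlap ε υ').charpoly = ∏ i, (X - C (mu i))) :
    (∀ i, lam i ≤ mu i) ∧
      (∀ i : Fin n, ∀ h : (i : ℕ) + 1 < n, mu i ≤ lam ⟨(i : ℕ) + 1, h⟩) := by
  have hυ' : ∀ v, 0 < υ' v := fun v => by
    by_cases h : v = v₀
    · rwa [h]
    · rw [hυ'eq v h]
      exact hυ v
  have hle : ∀ v, υ' v ≤ υ v := fun v => by
    by_cases h : v = v₀
    · rw [h]
      exact hυ'lt.le
    · exact (hυ'eq v h).le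
  have hL := lapMat_isHermitian hsym
  obtain ⟨P, hP, hPL⟩ := exists_weighted_diagonalizing_coords hL hυ hlam
  obtain ⟨Q, hQ, hQL⟩ := exists_weighted_diagonalizing_coords hL hυ' hmu
  refine ⟨fun i => ?_, fun i h => ?_⟩
  · obtain ⟨x, hx0, hx⟩ := exists_ne_zero_mulVec_eq_zero_of_card_lt
      (Matrix.of (Sum.elim (fun j : {j // j < i} => P j) (fun j : {j // i < j} => Q j)))
      (by
        have hi := i.isLt
        rw [Fintype.card_sum, Fintype.card_of_subtype (Finset.Iio i) fun _ => Finset.mem_Iio,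
          Fintype.card_of_subtype (Finset.Ioi i) fun _ => Finset.mem_Ioi, ← hn,
          Fin.card_Iio, Fin.card_Ioi]
        omega)
    have hl : lam i * ∑ v, υ v * x v ^ 2 ≤ x ⬝ᵥ (lapMat ε *ᵥ x) := by
      rw [hP, hPL]
      exact le_sum_mul_sq_of_forall_lt hlamMono fun j hj => congrFun hx (.inl ⟨j, hj⟩)
    have hu : x ⬝ᵥ (lapMat ε *ᵥ x) ≤ mu i * ∑ v, υ' v * x v ^ 2 := by
      rw [hQ, hQL]
      exact sum_mul_sq_le_of_forall_gt hmuMono fun j hj => congrFun hx (.inr ⟨j, hj⟩)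
    have hN := weighted_sum_sq_pos hυ hx0
    have hN' := weighted_sum_sq_pos hυ' hx0
    have hmu0 : 0 ≤ mu i := nonneg_of_mul_nonneg_left
      ((dotProduct_lapMat_mulVec_nonneg hsym hnonneg x).trans hu) hN'
    have hNN : ∑ v, υ' v * x v ^ 2 ≤ ∑ v, υ v * x v ^ 2 :=
      Finset.sum_le_sum fun v _ => mul_le_mul_of_nonneg_right (hle v) (sq_nonneg _)
    exact le_of_mul_le_mul_right
      (hl.trans (hu.trans (mul_le_mul_of_nonneg_left hNN hmu0))) hN
  · set k : Fin n := ⟨(i : ℕ) + 1, h⟩ with hk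
    obtain ⟨x, hx0, hx⟩ := exists_ne_zero_mulVec_eq_zero_of_card_lt
      (Matrix.of (Sum.elim (Sum.elim (fun j : {j // j < i} => Q j)
        (fun j : {j // k < j} => P j)) (fun _ : Unit => Pi.single v₀ 1)))
      (by
        have hkv : (k : ℕ) = i + 1 := rfl
        rw [Fintype.card_sum, Fintype.card_sum,
          Fintype.card_of_subtype (Finset.Iio i) fun _ => Finset.mem_Iio,
          Fintype.card_of_subtype (Finset.Ioi k) fun _ => Finset.mem_Ioi, ← hn,
          Fin.card_Iio, Fin.card_Ioi, Fintype.card_unit]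
        omega)
    have hl : mu i * ∑ v, υ' v * x v ^ 2 ≤ x ⬝ᵥ (lapMat ε *ᵥ x) := by
      rw [hQ, hQL]
      exact le_sum_mul_sq_of_forall_lt hmuMono fun j hj => congrFun hx (.inl (.inl ⟨j, hj⟩))
    have hu : x ⬝ᵥ (lapMat ε *ᵥ x) ≤ lam k * ∑ v, υ v * x v ^ 2 := by
      rw [hP, hPL]
      exact sum_mul_sq_le_of_forall_gt hlamMono fun j hj => congrFun hx (.inl (.inr ⟨j, hj⟩))
    have hxv : x v₀ = 0 := by
      have := congrFun hx (.inr ())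
      simpa [mulVec] using this
    have hNN : ∑ v, υ v * x v ^ 2 = ∑ v, υ' v * x v ^ 2 := by
      refine Finset.sum_congr rfl fun v _ => ?_
      by_cases hv : v = v₀
      · simp [hv, hxv]
      · rw [hυ'eq v hv]
    rw [hNN] at hu
    exact le_of_mul_le_mul_right (hl.trans hu) (weighted_sum_sq_pos hυ' hx0)
end

section
/- Let ε be an edge-weight function on a finite set V with n = |V| and d_ε(v) > 0 for all v ∈ V, let V' be a finite set with |V'| = n − k, and let q : V → V' be a surjection. Define quotient edge weights on V' by ε_q(x,y) = ∑_{u : q(u) = x} ∑_{v : q(v) = y} ε(u,v) for x ≠ y, with ε_q(x,x) = 0, and quotient degree weights by δ_q(x) = ∑_{v : q(v) = x} d_ε(v) (these are positive). Let λ_1 ≤ … ≤ λ_n denote the weighted Laplacian eigenvalues of (ε, d_ε) and μ_1 ≤ … ≤ μ_{n−k} the weighted Laplacian eigenvalues of (ε_q, δ_q). Then λ_i ≤ μ_i ≤ λ_{i+k} for all 1 ≤ i ≤ n−k. -/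
open Matrix Polynomial
open scoped Classical

/-- Two finite families with the same multiset of values agree up to reindexing. -/
lemma exists_equiv_comp_eq_of_map_univ_eq {ι κ α : Type*} [Fintype ι] [Fintype κ]
    {f : ι → α} {g : κ → α}
    (h : (Finset.univ : Finset ι).val.map f = (Finset.univ : Finset κ).val.map g) :
    ∃ σ : ι ≃ κ, ∀ i, g (σ i) = f i := by
  have hcard (c : α) : Fintype.card {i // f i = c} = Fintype.card {j // g j = c} := by
    have h2 := congrArg (Multiset.count c) h
    simp only [Multiset.count_map] at h2
    simp only [Fintype.card_subtype, Finset.card_def, Finset.filter_val]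
    simpa only [eq_comm] using h2
  exact ⟨Equiv.ofFiberEquiv fun c => Fintype.equivOfCardEq (hcard c),
    fun i => Equiv.ofFiberEquiv_map _ i⟩

/-- Simultaneous diagonalisation of a symmetric matrix `A` and a positive diagonal matrix
`diagonal υ`, with the eigenvalues of `(diagonal υ)⁻¹ * A` listed in a prescribed order. -/
lemma exists_simultaneous_diagonalization {ι V : Type*} [Fintype ι] [DecidableEq ι]
    [Fintype V] [DecidableEq V] {A : Matrix V V ℝ} (hA : Aᵀ = A) {υ : V → ℝ}
    (hυ : ∀ v, 0 < υ v) {lam : ι → ℝ}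
    (hlam : (diagonal (fun v => (υ v)⁻¹) * A).charpoly = ∏ i, (X - C (lam i))) :
    ∃ M : Matrix V ι ℝ, Mᵀ * diagonal υ * M = 1 ∧ M * Mᵀ * diagonal υ = 1 ∧
      Mᵀ * A * M = diagonal lam := by
  set S : Matrix V V ℝ := diagonal (fun v => (√(υ v))⁻¹) with hS
  have hST : Sᵀ = S := diagonal_transpose _
  have hpos (v : V) : √(υ v) ≠ 0 := (Real.sqrt_pos.2 (hυ v)).ne'
  have hSS : S * S = diagonal (fun v => (υ v)⁻¹) := by
    rw [hS, diagonal_mul_diagonal]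
    congr 1
    ext v
    rw [← mul_inv, Real.mul_self_sqrt (hυ v).le]
  have hSυS : S * diagonal υ * S = 1 := by
    rw [hS, diagonal_mul_diagonal, diagonal_mul_diagonal, ← diagonal_one]
    congr 1
    ext v
    have := hpos v
    field_simp
    exact (Real.sq_sqrt (hυ v).le).symm
  have hSSυ : S * S * diagonal υ = 1 := by
    rw [hSS, diagonal_mul_diagonal, ← diagonal_one]
    congr 1
    ext v
    exact inv_mul_cancel₀ (hυ v).ne'
  have hB : (S * A * S).IsHermitian := by
    rw [IsHermitian, conjTranspose_eq_transpose_of_trivial, transpose_mul, transpose_mul, hST, hA,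
      Matrix.mul_assoc]
  have hchar : (S * A * S).charpoly = ∏ i, (X - C (lam i)) := by
    rw [← hlam, charpoly_mul_comm, ← Matrix.mul_assoc, hSS]
  have hroots : (Finset.univ : Finset ι).val.map lam =
      (Finset.univ : Finset V).val.map hB.eigenvalues := by
    have h1 := hB.roots_charpoly_eq_eigenvalues
    rw [hchar, Polynomial.roots_prod _ _
      (Finset.prod_ne_zero_iff.2 fun i _ => X_sub_C_ne_zero _)] at h1
    simpa [Multiset.bind_singleton] using h1
  obtain ⟨σ, hσ⟩ := exists_equiv_comp_eq_of_map_univ_eq hroots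
  set U : Matrix V V ℝ := ↑hB.eigenvectorUnitary
  have hUU : Uᵀ * U = 1 := by
    have := Unitary.coe_star_mul_self hB.eigenvectorUnitary
    rwa [star_eq_conjTranspose, conjTranspose_eq_transpose_of_trivial] at this
  have hUU' : U * Uᵀ = 1 := mul_eq_one_comm.1 hUU
  have hspec : Uᵀ * (S * A * S) * U = diagonal hB.eigenvalues := by
    have := hB.conjStarAlgAut_star_eigenvectorUnitary
    rw [Unitary.conjStarAlgAut_star_apply, star_eq_conjTranspose,
      conjTranspose_eq_transpose_of_trivial] at this
    exact this
  have hsub (B : Matrix V V ℝ) : ((S * U).submatrix id σ)ᵀ * B * (S * U).submatrix id σ =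
      (Uᵀ * (S * B * S) * U).submatrix σ σ := by
    have : Uᵀ * (S * B * S) * U = (S * U)ᵀ * B * (S * U) := by
      simp only [transpose_mul, hST, Matrix.mul_assoc]
    rw [this]
    rfl
  refine ⟨(S * U).submatrix id σ, ?_, ?_, ?_⟩
  · rw [hsub, hSυS, Matrix.mul_one, hUU, submatrix_one_equiv]
  · rw [transpose_submatrix, submatrix_mul_equiv, submatrix_id_id, transpose_mul, hST,
      Matrix.mul_assoc S, ← Matrix.mul_assoc U, hUU', Matrix.one_mul, hSSυ]
  · rw [hsub, hspec]
    ext i j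
    simp [diagonal_apply, hσ]

/-- If `t` is smaller than `s`, then some nonzero vector supported on `s` has an image under `T`
vanishing on `t`. -/
lemma exists_ne_zero_supported_mulVec_eq_zero {ι κ : Type*} [Fintype ι]
    (T : Matrix κ ι ℝ) (s : Finset ι) (t : Finset κ) (hst : t.card < s.card) :
    ∃ c : ι → ℝ, c ≠ 0 ∧ (∀ i ∉ s, c i = 0) ∧ ∀ j ∈ t, (T *ᵥ c) j = 0 := by
  let f : (s → ℝ) →ₗ[ℝ] (t → ℝ) :=
    (T.submatrix (fun j : t => (j : κ)) (fun i : s => (i : ι))).mulVecLin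
  obtain ⟨c, hc, hc0⟩ := (Submodule.ne_bot_iff _).1
    (LinearMap.ker_ne_bot_of_finrank_lt (f := f) (by simpa using hst))
  refine ⟨fun i => if h : i ∈ s then c ⟨i, h⟩ else 0, fun h => hc0 ?_, fun i hi => dif_neg hi,
    fun j hj => ?_⟩
  · ext i
    simpa using congrFun h i
  · have h := congrFun (LinearMap.mem_ker.1 hc) ⟨j, hj⟩
    simp only [f, mulVecLin_apply, mulVec, dotProduct, submatrix_apply, Pi.zero_apply] at h ⊢
    rw [← Finset.sum_subset (Finset.subset_univ s) (fun i _ hi => by rw [dif_neg hi, mul_zero]),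
      ← Finset.sum_coe_sort s, ← h]
    exact Finset.sum_congr rfl fun i _ => by simp

lemma dotProduct_diagonal_mulVec {ι : Type*} [Fintype ι] [DecidableEq ι] (a c : ι → ℝ) :
    c ⬝ᵥ (diagonal a *ᵥ c) = ∑ i, a i * c i ^ 2 := by
  simp only [dotProduct, mulVec_diagonal]
  exact Finset.sum_congr rfl fun i _ => by ring

/-- **Cauchy interlacing** for the compression `Tᵀ * diagonal lam * T` of a diagonal matrix by an
isometry `T`. -/
lemma cauchy_interlacing {m n k : ℕ} (hmn : m + k = n) (T : Matrix (Fin n) (Fin m) ℝ)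
    (hT : Tᵀ * T = 1) {lam : Fin n → ℝ} (hlam : Monotone lam) {mu : Fin m → ℝ} (hmu : Monotone mu)
    (hTlam : Tᵀ * diagonal lam * T = diagonal mu) (i : Fin m) :
    lam ⟨i, by omega⟩ ≤ mu i ∧ mu i ≤ lam ⟨i + k, by omega⟩ := by
  have hnorm (c : Fin m → ℝ) : ∑ j, (T *ᵥ c) j ^ 2 = ∑ i, c i ^ 2 := by
    have : (T *ᵥ c) ⬝ᵥ (T *ᵥ c) = c ⬝ᵥ c := by
      rw [dotProduct_mulVec, ← mulVec_transpose, mulVec_mulVec, hT, one_mulVec]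
    simpa only [dotProduct, ← sq] using this
  have hform (c : Fin m → ℝ) : ∑ j, lam j * (T *ᵥ c) j ^ 2 = ∑ i, mu i * c i ^ 2 := by
    rw [← dotProduct_diagonal_mulVec, ← dotProduct_diagonal_mulVec, ← hTlam, ← mulVec_mulVec,
      ← mulVec_mulVec, dotProduct_mulVec c, ← mulVec_transpose, transpose_transpose]
  have hpos {c : Fin m → ℝ} (hc : c ≠ 0) : 0 < ∑ i, c i ^ 2 := by
    obtain ⟨j, hj⟩ := Function.ne_iff.1 hc
    exact Finset.sum_pos' (fun i _ => sq_nonneg _) ⟨j, Finset.mem_univ _, sq_pos_of_ne_zero hj⟩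
  constructor
  · obtain ⟨c, hc, hcs, hct⟩ := exists_ne_zero_supported_mulVec_eq_zero T (Finset.Iic i)
      (Finset.Iio ⟨i, by omega⟩) (by simp)
    refine le_of_mul_le_mul_right ?_ (hpos hc)
    calc _ = ∑ j, lam ⟨i, by omega⟩ * (T *ᵥ c) j ^ 2 := by rw [← hnorm, Finset.mul_sum]
      _ ≤ ∑ j, lam j * (T *ᵥ c) j ^ 2 := Finset.sum_le_sum fun j _ => by
        by_cases h : j < ⟨i, by omega⟩
        · simp [hct j (Finset.mem_Iio.2 h)]
        · exact mul_le_mul_of_nonneg_right (hlam (not_lt.1 h)) (sq_nonneg _)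
      _ = ∑ j, mu j * c j ^ 2 := hform c
      _ ≤ ∑ j, mu i * c j ^ 2 := Finset.sum_le_sum fun j _ => by
        by_cases h : j ≤ i
        · exact mul_le_mul_of_nonneg_right (hmu h) (sq_nonneg _)
        · simp [hcs j (by simpa using h)]
      _ = _ := by rw [Finset.mul_sum]
  · obtain ⟨c, hc, hcs, hct⟩ := exists_ne_zero_supported_mulVec_eq_zero T (Finset.Ici i)
      (Finset.Ioi ⟨i + k, by omega⟩) (by simp; omega)
    refine le_of_mul_le_mul_right ?_ (hpos hc)
    calc _ = ∑ j, mu i * c j ^ 2 := by rw [Finset.mul_sum]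
      _ ≤ ∑ j, mu j * c j ^ 2 := Finset.sum_le_sum fun j _ => by
        by_cases h : i ≤ j
        · exact mul_le_mul_of_nonneg_right (hmu h) (sq_nonneg _)
        · simp [hcs j (by simpa using h)]
      _ = ∑ j, lam j * (T *ᵥ c) j ^ 2 := (hform c).symm
      _ ≤ ∑ j, lam ⟨i + k, by omega⟩ * (T *ᵥ c) j ^ 2 := Finset.sum_le_sum fun j _ => by
        by_cases h : ⟨i + k, by omega⟩ < j
        · simp [hct j (Finset.mem_Ioi.2 h)]
        · exact mul_le_mul_of_nonneg_right (hlam (not_lt.1 h)) (sq_nonneg _)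
      _ = _ := by rw [← hnorm, Finset.mul_sum]

/-- The `V × V'` incidence matrix of a map `q : V → V'`. -/
def fiberMatrix {V V' : Type*} [DecidableEq V'] (q : V → V') : Matrix V V' ℝ :=
  Matrix.of fun v x => if q v = x then 1 else 0

lemma fiberMatrix_transpose_mul_mul {V V' : Type*} [Fintype V] [DecidableEq V']
    (q : V → V') (A : Matrix V V ℝ) (x y : V') :
    ((fiberMatrix q)ᵀ * A * fiberMatrix q) x y =
      ∑ u with q u = x, ∑ v with q v = y, A u v := by
  simp only [Matrix.mul_apply, transpose_apply, fiberMatrix, of_apply, ite_mul, one_mul, zero_mul,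
    mul_ite, mul_one, mul_zero]
  simp only [← Finset.sum_filter]
  exact Finset.sum_comm

lemma fiberMatrix_transpose_mul_diagonal_mul {V V' : Type*} [Fintype V] [DecidableEq V]
    [DecidableEq V'] (q : V → V') (υ : V → ℝ) :
    (fiberMatrix q)ᵀ * diagonal υ * fiberMatrix q =
      diagonal fun x => ∑ v with q v = x, υ v := by
  ext x y
  rw [fiberMatrix_transpose_mul_mul, diagonal_apply]
  simp only [diagonal_apply, Finset.sum_ite_eq, Finset.mem_filter, Finset.mem_univ, true_and]
  split_ifs with h
  · subst h
    exact Finset.sum_congr rfl fun u hu => if_pos (Finset.mem_filter.1 hu).2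
  · exact Finset.sum_eq_zero fun u hu => if_neg fun huy =>
      h ((Finset.mem_filter.1 hu).2.symm.trans huy)

lemma lapMat_transpose {V : Type} [Fintype V] [DecidableEq V] {ε : V → V → ℝ}
    (hsym : ∀ u v, ε u v = ε v u) : (lapMat ε)ᵀ = lapMat ε := by
  rw [lapMat, transpose_sub, diagonal_transpose]
  congr 1
  ext u v
  exact hsym v u

lemma fiberMatrix_transpose_mul_lapMat_mul {V V' : Type} [Fintype V] [DecidableEq V] [Fintype V']
    [DecidableEq V'] (q : V → V') (ε : V → V → ℝ) :
    (fiberMatrix q)ᵀ * lapMat ε * fiberMatrix q =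
      lapMat fun x y => if x = y then 0 else ∑ u with q u = x, ∑ v with q v = y, ε u v := by
  ext x y
  rw [lapMat, Matrix.mul_sub, Matrix.sub_mul, fiberMatrix_transpose_mul_diagonal_mul, Matrix.sub_apply,
    fiberMatrix_transpose_mul_mul, lapMat, Matrix.sub_apply, diagonal_apply, diagonal_apply]
  simp only [of_apply]
  split_ifs with h
  · subst h
    have htotal : ∑ u with q u = x, ∑ v, ε u v =
        ∑ y, ∑ u with q u = x, ∑ v with q v = y, ε u v :=
      (Finset.sum_congr rfl fun u _ => (Finset.sum_fiberwise _ q _).symm).trans Finset.sum_comm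
    rw [htotal, ← Finset.add_sum_erase _ _ (Finset.mem_univ x), add_sub_cancel_left, sub_zero,
      ← Finset.add_sum_erase (a := x) _ _ (Finset.mem_univ x), if_pos rfl, zero_add]
    exact Finset.sum_congr rfl fun y hy => (if_neg (Finset.ne_of_mem_erase hy).symm).symm
  · rfl

/-- **Normalised Laplacian quotient interlacing**: the normalised Laplacian eigenvalues
of a quotient graph satisfy `λᵢ ≤ μᵢ ≤ λ_{i+k}`. -/
theorem interlacing_normalised_quotient
    {V V' : Type} [Fintype V] [DecidableEq V] [Fintype V'] [DecidableEq V']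
    (ε : V → V → ℝ) (hsym : ∀ u v, ε u v = ε v u)
    (hnonneg : ∀ u v, 0 ≤ ε u v) (hdiag : ∀ v, ε v v = 0)
    (hdeg : ∀ v, 0 < ∑ u, ε v u)
    (n k : ℕ) (hn : n = Fintype.card V) (hcard : Fintype.card V' + k = n)
    (q : V → V') (hq : Function.Surjective q)
    (εq : V' → V' → ℝ)
    (hεq : εq = fun x y => if x = y then 0 else
      ∑ u ∈ Finset.univ.filter (fun u => q u = x),
        ∑ v ∈ Finset.univ.filter (fun v => q v = y), ε u v)
    (δq : V' → ℝ)
    (hδq : δq = fun x => ∑ v ∈ Finset.univ.filter (fun v => q v = x), ∑ u, ε v u)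
    (lam : Fin n → ℝ) (hlamMono : Monotone lam)
    (hlam : (wlap ε (fun v => ∑ u, ε v u)).charpoly = ∏ i, (X - C (lam i)))
    (mu : Fin (n - k) → ℝ) (hmuMono : Monotone mu)
    (hmu : (wlap εq δq).charpoly = ∏ i, (X - C (mu i))) :
    ∀ i : Fin (n - k),
      lam ⟨(i : ℕ), by have := i.2; omega⟩ ≤ mu i ∧
      mu i ≤ lam ⟨(i : ℕ) + k, by have := i.2; omega⟩ := by
  have hm : n - k + k = n := by omega
  intro i
  have hδpos (x : V') : 0 < δq x := by
    obtain ⟨v, hv⟩ := hq x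
    rw [hδq]
    exact Finset.sum_pos (fun v _ => hdeg v) ⟨v, by simpa using hv⟩
  have hsymq (x y : V') : εq x y = εq y x := by
    simp only [hεq, eq_comm (a := x) (b := y)]
    split_ifs with h
    · rfl
    · rw [Finset.sum_comm]
      exact Finset.sum_congr rfl fun u _ => Finset.sum_congr rfl fun v _ => hsym _ _
  obtain ⟨M, -, hM, hMlam⟩ :=
    exists_simultaneous_diagonalization (lapMat_transpose hsym) hdeg hlam
  obtain ⟨R, hR, -, hRmu⟩ :=
    exists_simultaneous_diagonalization (lapMat_transpose hsymq) hδpos hmu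
  set D : Matrix V V ℝ := diagonal fun v => ∑ u, ε v u
  have hDT : Dᵀ = D := diagonal_transpose _
  have hM' : D * (M * Mᵀ) = 1 := mul_eq_one_comm.1 hM
  have hJD : (fiberMatrix q)ᵀ * D * fiberMatrix q = diagonal δq := by
    rw [fiberMatrix_transpose_mul_diagonal_mul, hδq]
  have hJL : (fiberMatrix q)ᵀ * lapMat ε * fiberMatrix q = lapMat εq := by
    rw [fiberMatrix_transpose_mul_lapMat_mul, hεq]
  refine cauchy_interlacing hm (Mᵀ * D * fiberMatrix q * R) ?_ hlamMono hmuMono ?_ i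
  · calc (Mᵀ * D * fiberMatrix q * R)ᵀ * (Mᵀ * D * fiberMatrix q * R)
        = Rᵀ * ((fiberMatrix q)ᵀ * (D * (M * Mᵀ)) * D * fiberMatrix q) * R := by
          simp only [transpose_mul, transpose_transpose, hDT, Matrix.mul_assoc]
      _ = 1 := by rw [hM', Matrix.mul_one, hJD, hR]
  · calc (Mᵀ * D * fiberMatrix q * R)ᵀ * diagonal lam * (Mᵀ * D * fiberMatrix q * R)
        = Rᵀ * ((fiberMatrix q)ᵀ * ((D * (M * Mᵀ)) * lapMat ε * (M * Mᵀ * D)) *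
            fiberMatrix q) * R := by
          simp only [← hMlam, transpose_mul, transpose_transpose, hDT, Matrix.mul_assoc]
      _ = diagonal mu := by rw [hM', hM, Matrix.mul_one, Matrix.one_mul, hJL, hRmu]
end

section
/- Let U be a finite set and A, B ⊆ U with A ∪ B = U; set n = |A|, k = |U ∖ A|, s = |B|. Let ε be an edge-weight function on U with ε(u,v) = 0 unless u,v ∈ A, and ε' an edge-weight function on U with ε'(u,v) = 0 unless u,v ∈ B. Let υ : A → ℝ_{>0} and υ' : B → ℝ_{>0}, and define vertex weights τ on U by τ(u) = (υ(u) if u ∈ A, else 0) + (υ'(u) if u ∈ B, else 0) (these are positive). Let λ_1 ≤ … ≤ λ_n denote the weighted Laplacian eigenvalues of (ε restricted to A, υ), let μ_1 ≤ … ≤ μ_{n+k} denote the weighted Laplacian eigenvalues of (ε + ε', τ) on U, let c be the number of connected components of the simple graph on B in which distinct u,v are adjacent iff ε'(u,v) > 0, and let b be the number of weighted Laplacian eigenvalues of (ε' restricted to B, υ') that are ≥ λ_n. Then for all 1 ≤ i ≤ n: μ_{i−s+c+k} ≤ λ_i whenever i−s+c+k ≥ 1, and λ_i ≤ μ_{i+s−b}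 whenever i+s−b ≤ n+k. -/
open Matrix Polynomial
open scoped Classical

theorem dotProduct_lapMat_mulVec {V : Type} [Fintype V] [DecidableEq V] (ε : V → V → ℝ)
    (hsym : ∀ u v, ε u v = ε v u) (x : V → ℝ) :
    x ⬝ᵥ (lapMat ε *ᵥ x) = ∑ u, ∑ v, ε u v * (x u - x v) ^ 2 / 2 := by
  have h1 : x ⬝ᵥ (lapMat ε *ᵥ x) = ∑ u, ∑ v, ε u v * (x u ^ 2 - x u * x v) := by
    rw [lapMat, sub_mulVec, dotProduct_sub]
    simp only [dotProduct, mulVec_diagonal]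
    simp only [mulVec, dotProduct, of_apply]
    rw [← Finset.sum_sub_distrib]
    refine Finset.sum_congr rfl fun u _ => ?_
    rw [Finset.sum_mul, Finset.mul_sum, Finset.mul_sum, ← Finset.sum_sub_distrib]
    exact Finset.sum_congr rfl fun v _ => by ring
  have h2 : ∑ u, ∑ v, ε u v * (x u ^ 2 - x u * x v)
      = ∑ u, ∑ v, ε u v * (x v ^ 2 - x u * x v) := by
    rw [Finset.sum_comm]
    refine Finset.sum_congr rfl fun u _ => Finset.sum_congr rfl fun v _ => ?_
    rw [hsym v u]; ring
  have h3 : ∑ u, ∑ v, ε u v * (x u - x v) ^ 2 / 2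
      = (∑ u, ∑ v, ε u v * (x u ^ 2 - x u * x v)
        + ∑ u, ∑ v, ε u v * (x v ^ 2 - x u * x v)) / 2 := by
    simp only [← Finset.sum_add_distrib, Finset.sum_div]
    exact Finset.sum_congr rfl fun u _ => Finset.sum_congr rfl fun v _ => by ring
  rw [h3, ← h2, h1]; ring

/-- Two finite families with the same multiset of values differ by a reindexing. -/
theorem exists_equiv_of_map_univ_eq {α β γ : Type} [Fintype α] [Fintype β]
    (f : α → γ) (g : β → γ) (h : Finset.univ.val.map f = Finset.univ.val.map g) :
    ∃ σ : β ≃ α, ∀ i, f (σ i) = g i := by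
  have hcard : ∀ a, Nonempty ({i // g i = a} ≃ {i // f i = a}) := fun a => by
    refine Fintype.card_eq.1 ?_
    have := congrArg (Multiset.count a) h
    rw [Multiset.count_map, Multiset.count_map] at this
    rw [Fintype.card_subtype, Fintype.card_subtype, Finset.card_def, Finset.card_def,
      Finset.filter_val, Finset.filter_val]
    simpa only [eq_comm] using this.symm
  exact ⟨Equiv.ofFiberEquiv fun a => (hcard a).some, Equiv.ofFiberEquiv_map _⟩

/-- A symmetric edge-weighted Laplacian and a positive vertex-weight form are simultaneously
diagonalised by a linear change of coordinates, with the weighted eigenvalues on the diagonal. -/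
theorem exists_diagonalizing_coords {V : Type} [Fintype V] [DecidableEq V] {m : ℕ}
    (ε : V → V → ℝ) (hsym : ∀ u v, ε u v = ε v u) (υ : V → ℝ) (hυ : ∀ v, 0 < υ v)
    (lam : Fin m → ℝ) (h : (wlap ε υ).charpoly = ∏ i, (X - C (lam i))) :
    ∃ f : (V → ℝ) →ₗ[ℝ] (Fin m → ℝ), Function.Surjective f ∧
      (∀ x, ∑ i, f x i ^ 2 = ∑ v, υ v * x v ^ 2) ∧
      (∀ x, ∑ i, lam i * f x i ^ 2 = ∑ u, ∑ v, ε u v * (x u - x v) ^ 2 / 2) := by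
  have hLt : (lapMat ε)ᵀ = lapMat ε := by
    ext u v
    by_cases huv : u = v
    · subst huv; simp [lapMat]
    · simp [lapMat, huv, Ne.symm huv, hsym u v]
  set d : V → ℝ := fun v => √(υ v) with hd
  have hdpos : ∀ v, 0 < d v := fun v => Real.sqrt_pos.2 (hυ v)
  have hdsq : ∀ v, d v * d v = υ v := fun v => Real.mul_self_sqrt (hυ v).le
  set R : Matrix V V ℝ := diagonal (fun v => (d v)⁻¹) with hR
  set S : Matrix V V ℝ := R * lapMat ε * R with hS
  have hSH : S.IsHermitian := by
    rw [Matrix.IsHermitian, conjTranspose_eq_transpose_of_trivial, hS, transpose_mul,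
      transpose_mul, hLt, hR, diagonal_transpose, Matrix.mul_assoc]
  have hRR : R * R = diagonal (fun v => (υ v)⁻¹) := by
    rw [hR, diagonal_mul_diagonal]
    congr 1; ext v; rw [← hdsq, mul_inv]
  have hchar : S.charpoly = ∏ i, (X - C (lam i)) := by
    rw [← h, hS, Matrix.charpoly_mul_comm, ← Matrix.mul_assoc, hRR, wlap]
  have hprod : ∏ v, (X - C (hSH.eigenvalues v)) = ∏ i, (X - C (lam i)) := by
    rw [← hchar, hSH.charpoly_eq]; rfl
  have hms : (Finset.univ.val.map hSH.eigenvalues) = Finset.univ.val.map lam := by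
    rw [← Polynomial.roots_multiset_prod_X_sub_C (Finset.univ.val.map hSH.eigenvalues),
      ← Polynomial.roots_multiset_prod_X_sub_C (Finset.univ.val.map lam), Multiset.map_map,
      Multiset.map_map]
    exact congrArg Polynomial.roots hprod
  obtain ⟨σ, hσ⟩ := exists_equiv_of_map_univ_eq hSH.eigenvalues lam hms
  set W : Matrix V V ℝ := hSH.eigenvectorUnitary.1 with hW
  have hWW : W * Wᵀ = 1 := Unitary.coe_mul_star_self hSH.eigenvectorUnitary
  have hWW' : Wᵀ * W = 1 := Unitary.coe_star_mul_self hSH.eigenvectorUnitary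
  have hspec : S = W * diagonal hSH.eigenvalues * Wᵀ := by
    have := hSH.spectral_theorem
    rw [Unitary.conjStarAlgAut_apply] at this
    exact this
  set D : Matrix V V ℝ := diagonal d with hD
  have hRD : R * D = 1 := by
    rw [hR, hD, diagonal_mul_diagonal, ← diagonal_one]
    congr 1; ext v; exact inv_mul_cancel₀ (hdpos v).ne'
  have hDR : D * R = 1 := by
    rw [hR, hD, diagonal_mul_diagonal, ← diagonal_one]
    congr 1; ext v; exact mul_inv_cancel₀ (hdpos v).ne'
  have hDt : Dᵀ = D := diagonal_transpose d
  have hL : lapMat ε = (Wᵀ * D)ᵀ * diagonal hSH.eigenvalues * (Wᵀ * D) := by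
    calc lapMat ε = (D * R) * lapMat ε * (R * D) := by rw [hDR, hRD, one_mul, mul_one]
      _ = D * S * D := by simp only [hS, Matrix.mul_assoc]
      _ = D * (W * diagonal hSH.eigenvalues * Wᵀ) * D := congrArg (D * · * D) hspec
      _ = _ := by
        rw [transpose_mul, transpose_transpose, hDt]
        simp only [Matrix.mul_assoc]
  have hM : diagonal υ = (Wᵀ * D)ᵀ * (Wᵀ * D) := by
    rw [transpose_mul, transpose_transpose, hDt, Matrix.mul_assoc, ← Matrix.mul_assoc W, hWW,
      one_mul, hD, diagonal_mul_diagonal]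
    simp only [hdsq]
  refine ⟨LinearMap.funLeft ℝ ℝ σ ∘ₗ (Wᵀ * D).mulVecLin, ?_, fun x => ?_, fun x => ?_⟩
  · rw [LinearMap.coe_comp]
    refine (LinearMap.funLeft_surjective_of_injective ℝ ℝ σ σ.injective).comp fun y => ?_
    refine ⟨(R * W) *ᵥ y, ?_⟩
    rw [mulVecLin_apply, mulVec_mulVec, Matrix.mul_assoc, ← Matrix.mul_assoc D, hDR, one_mul,
      hWW', one_mulVec]
  · have h1 : x ⬝ᵥ (diagonal υ *ᵥ x) = ∑ v, υ v * x v ^ 2 := by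
      simp only [dotProduct, mulVec_diagonal]
      exact Finset.sum_congr rfl fun v _ => by ring
    rw [← h1, hM, ← mulVec_mulVec, dotProduct_mulVec, vecMul_transpose]
    simp only [dotProduct, LinearMap.comp_apply, LinearMap.funLeft_apply, mulVecLin_apply]
    rw [Equiv.sum_comp σ fun v => ((Wᵀ * D) *ᵥ x) v ^ 2]
    exact Finset.sum_congr rfl fun v _ => by ring
  · rw [← dotProduct_lapMat_mulVec ε hsym x, hL, ← mulVec_mulVec, ← mulVec_mulVec,
      dotProduct_mulVec, vecMul_transpose]
    simp only [dotProduct, LinearMap.comp_apply, LinearMap.funLeft_apply, mulVecLin_apply,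
      ← hσ, mulVec_diagonal]
    rw [Equiv.sum_comp σ fun v => hSH.eigenvalues v * ((Wᵀ * D) *ᵥ x) v ^ 2]
    exact Finset.sum_congr rfl fun v _ => by ring

theorem exists_ne_zero_of_card_lt {V ι₁ ι₂ ι₃ : Type} [Fintype V] [Fintype ι₁] [Fintype ι₂]
    [Fintype ι₃] (f₁ : (V → ℝ) →ₗ[ℝ] (ι₁ → ℝ)) (f₂ : (V → ℝ) →ₗ[ℝ] (ι₂ → ℝ))
    (f₃ : (V → ℝ) →ₗ[ℝ] (ι₃ → ℝ))
    (h : Fintype.card ι₁ + Fintype.card ι₂ + Fintype.card ι₃ < Fintype.card V) :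
    ∃ x ≠ 0, f₁ x = 0 ∧ f₂ x = 0 ∧ f₃ x = 0 := by
  have hk : LinearMap.ker (f₁.prod (f₂.prod f₃)) ≠ ⊥ := by
    apply LinearMap.ker_ne_bot_of_finrank_lt
    simp only [Module.finrank_prod, Module.finrank_fintype_fun_eq_card]
    omega
  obtain ⟨x, hx, hx0⟩ := Submodule.exists_mem_ne_zero_of_ne_bot hk
  simp only [LinearMap.mem_ker, LinearMap.prod_apply, Function.prod, Prod.mk_eq_zero] at hx
  exact ⟨x, hx0, hx⟩

/-- Restricting coordinates to a subset of the index set. -/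
def restrictCoords {ι : Type} (p : ι → Prop) : (ι → ℝ) →ₗ[ℝ] ({i // p i} → ℝ) :=
  LinearMap.funLeft ℝ ℝ Subtype.val

theorem restrictCoords_eq_zero {ι : Type} {p : ι → Prop} {y : ι → ℝ}
    (h : restrictCoords p y = 0) (i : ι) (hi : p i) : y i = 0 :=
  congrFun h ⟨i, hi⟩

theorem sum_mul_sq_le {ι : Type} [Fintype ι] {a y : ι → ℝ} {t : ℝ}
    (h : ∀ i, y i ≠ 0 → a i ≤ t) : ∑ i, a i * y i ^ 2 ≤ t * ∑ i, y i ^ 2 := by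
  rw [Finset.mul_sum]
  refine Finset.sum_le_sum fun i _ => ?_
  by_cases hi : y i = 0
  · simp [hi]
  · exact mul_le_mul_of_nonneg_right (h i hi) (sq_nonneg _)

theorem le_sum_mul_sq {ι : Type} [Fintype ι] {a y : ι → ℝ} {t : ℝ}
    (h : ∀ i, y i ≠ 0 → t ≤ a i) : t * ∑ i, y i ^ 2 ≤ ∑ i, a i * y i ^ 2 := by
  rw [Finset.mul_sum]
  refine Finset.sum_le_sum fun i _ => ?_
  by_cases hi : y i = 0
  · simp [hi]
  · exact mul_le_mul_of_nonneg_right (h i hi) (sq_nonneg _)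

theorem sum_subtype_of_support {U : Type} [Fintype U] (A : Finset U) (g : U → ℝ)
    (h : ∀ u, g u ≠ 0 → u ∈ A) : ∑ x : {u // u ∈ A}, g x.1 = ∑ u, g u := by
  rw [Finset.sum_coe_sort A g]
  exact Finset.sum_subset (Finset.subset_univ A) fun u _ hu => by
    by_contra hne; exact hu (h u hne)

theorem sum_sum_subtype_of_support {U : Type} [Fintype U] (A : Finset U) (ε : U → U → ℝ)
    (h : ∀ u v, ε u v ≠ 0 → u ∈ A ∧ v ∈ A) (x : U → ℝ) :
    ∑ u : {u // u ∈ A}, ∑ v : {u // u ∈ A}, ε u.1 v.1 * (x u.1 - x v.1) ^ 2 / 2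
      = ∑ u, ∑ v, ε u v * (x u - x v) ^ 2 / 2 := by
  have hin : ∀ u, ∑ v : {u // u ∈ A}, ε u v.1 * (x u - x v.1) ^ 2 / 2
      = ∑ v, ε u v * (x u - x v) ^ 2 / 2 := fun u =>
    sum_subtype_of_support A (fun v => ε u v * (x u - x v) ^ 2 / 2) fun v hv =>
      (h u v fun h0 => hv (by simp [h0])).2
  simp only [hin]
  refine sum_subtype_of_support A (fun u => ∑ v, ε u v * (x u - x v) ^ 2 / 2) fun u hu => ?_
  obtain ⟨v, -, hv⟩ := Finset.exists_ne_zero_of_sum_ne_zero hu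
  exact (h u v fun h0 => hv (by simp [h0])).1

/-- Functions constant on connected components are cut out by `|V| - c` linear equations. -/
theorem exists_coords_constant_on_components {V : Type} [Fintype V] (G : SimpleGraph V) :
    ∃ (ι : Type) (_ : Fintype ι) (f : (V → ℝ) →ₗ[ℝ] (ι → ℝ)),
      Fintype.card ι + Nat.card G.ConnectedComponent = Fintype.card V ∧
      ∀ x, f x = 0 → ∀ u v, G.Adj u v → x u = x v := by
  let r : V → V := fun v => (G.connectedComponentMk v).out
  have hr : ∀ C : G.ConnectedComponent, G.connectedComponentMk C.out = C := fun C => C.out_eq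
  refine ⟨{v // r v ≠ v}, inferInstance,
    restrictCoords (fun v => r v ≠ v) ∘ₗ (LinearMap.funLeft ℝ ℝ r - LinearMap.id), ?_, ?_⟩
  · have he : G.ConnectedComponent ≃ {v // r v = v} :=
      { toFun := fun C => ⟨C.out, by simp only [r, hr]⟩
        invFun := fun v => G.connectedComponentMk v.1
        left_inv := hr
        right_inv := fun v => Subtype.ext v.2 }
    rw [Nat.card_congr he, Nat.card_eq_fintype_card, add_comm]
    have := Fintype.card_subtype_compl fun v => r v = v
    have := Fintype.card_subtype_le fun v => r v = v
    simp only [ne_eq]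
    omega
  · intro x hx u v huv
    have key : ∀ w, x (r w) = x w := fun w => by
      by_cases hw : r w = w
      · rw [hw]
      · have h0 : x (r w) - x w = 0 :=
          restrictCoords_eq_zero (p := fun v => r v ≠ v)
            (y := (LinearMap.funLeft ℝ ℝ r - LinearMap.id : (V → ℝ) →ₗ[ℝ] (V → ℝ)) x) hx w hw
        exact sub_eq_zero.1 h0
    rw [← key u, ← key v]
    simp only [r, SimpleGraph.ConnectedComponent.sound huv.reachable]

/-- **Merge interlacing**: interlacing between the weighted Laplacian eigenvalues of
`(G, υ, ε)` and of the merge `(G + G', υ + υ', ε + ε')`: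
`μ_{i-s+c+k} ≤ λᵢ` and `λᵢ ≤ μ_{i+s-b}`. -/
theorem interlacing_merge
    {U : Type} [Fintype U] [DecidableEq U]
    (A B : Finset U) (hAB : A ∪ B = Finset.univ)
    (n k s : ℕ) (hn : n = A.card) (hk : k = (Finset.univ \ A).card) (hs : s = B.card)
    (hn1 : 0 < n)
    (ε ε' : U → U → ℝ)
    (hsym : ∀ u v, ε u v = ε v u) (hnonneg : ∀ u v, 0 ≤ ε u v) (hdiag : ∀ v, ε v v = 0)
    (hsym' : ∀ u v, ε' u v = ε' v u) (hnonneg' : ∀ u v, 0 ≤ ε' u v)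
    (hdiag' : ∀ v, ε' v v = 0)
    (hεA : ∀ u v, ε u v ≠ 0 → u ∈ A ∧ v ∈ A)
    (hε'B : ∀ u v, ε' u v ≠ 0 → u ∈ B ∧ v ∈ B)
    (υ : U → ℝ) (hυ : ∀ u ∈ A, 0 < υ u)
    (υ' : U → ℝ) (hυ' : ∀ u ∈ B, 0 < υ' u)
    (τ : U → ℝ)
    (hτ : τ = fun u => (if u ∈ A then υ u else 0) + (if u ∈ B then υ' u else 0))
    (lam : Fin n → ℝ) (hlamMono : Monotone lam)
    (hlam : (wlap (fun x y : {u // u ∈ A} => ε x.1 y.1) (fun x => υ x.1)).charpoly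
        = ∏ i, (X - C (lam i)))
    (mu : Fin (n + k) → ℝ) (hmuMono : Monotone mu)
    (hmu : (wlap (fun u v => ε u v + ε' u v) τ).charpoly = ∏ i, (X - C (mu i)))
    (eta : Fin s → ℝ) (hetaMono : Monotone eta)
    (heta : (wlap (fun x y : {u // u ∈ B} => ε' x.1 y.1) (fun x => υ' x.1)).charpoly
        = ∏ i, (X - C (eta i)))
    (c : ℕ)
    (hc : c = Nat.card
      (SimpleGraph.fromRel (fun x y : {u // u ∈ B} => 0 < ε' x.1 y.1)).ConnectedComponent)
    (b : ℕ)
    (hb : b = (Finset.univ.filter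
      (fun i : Fin s => lam ⟨n - 1, by omega⟩ ≤ eta i)).card) :
    (∀ (i : Fin n) (j : Fin (n + k)),
        (j : ℕ) + 1 + s = (i : ℕ) + 1 + c + k → mu j ≤ lam i) ∧
    (∀ (i : Fin n) (j : Fin (n + k)),
        (j : ℕ) + 1 + b = (i : ℕ) + 1 + s → lam i ≤ mu j) := by
  have hτpos : ∀ u, 0 < τ u := fun u => by
    have hu : u ∈ A ∪ B := hAB ▸ Finset.mem_univ u
    rw [hτ]
    by_cases hA : u ∈ A <;> by_cases hB : u ∈ B
    · simpa [hA, hB] using add_pos (hυ u hA) (hυ' u hB)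
    · simpa [hA, hB] using hυ u hA
    · simpa [hA, hB] using hυ' u hB
    · simp [hA, hB] at hu
  have hcardU : Fintype.card U = n + k := by
    rw [hn, hk, ← Finset.card_univ, add_comm]
    exact (Finset.card_sdiff_add_card_eq_card (Finset.subset_univ A)).symm
  have hcardB : Fintype.card {u // u ∈ B} = s := by rw [hs]; exact Fintype.card_coe B
  obtain ⟨fA, hAsurj, hAM, hAQ⟩ := exists_diagonalizing_coords
    (fun x y : {u // u ∈ A} => ε x.1 y.1) (fun x y => hsym x.1 y.1)
    (fun x => υ x.1) (fun x => hυ x.1 x.2) lam hlam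
  obtain ⟨fB, -, hBM, hBQ⟩ := exists_diagonalizing_coords
    (fun x y : {u // u ∈ B} => ε' x.1 y.1) (fun x y => hsym' x.1 y.1)
    (fun x => υ' x.1) (fun x => hυ' x.1 x.2) eta heta
  obtain ⟨fU, -, hUM, hUQ⟩ := exists_diagonalizing_coords
    (fun u v => ε u v + ε' u v) (fun x y => by rw [hsym x y, hsym' x y]) τ hτpos mu hmu
  let rA : (U → ℝ) →ₗ[ℝ] ({u // u ∈ A} → ℝ) := LinearMap.funLeft ℝ ℝ Subtype.val
  let rB : (U → ℝ) →ₗ[ℝ] ({u // u ∈ B} → ℝ) := LinearMap.funLeft ℝ ℝ Subtype.val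
  have hlam0 : ∀ i, 0 ≤ lam i := fun i => by
    obtain ⟨x, hx⟩ := hAsurj (Pi.single i 1)
    have h1 : ∑ l, lam l * (Pi.single i 1 : Fin n → ℝ) l ^ 2 = lam i := by
      simp [Pi.single_apply]
    rw [← h1, ← hx, hAQ]
    exact Finset.sum_nonneg fun u _ => Finset.sum_nonneg fun v _ =>
      div_nonneg (mul_nonneg (hnonneg _ _) (sq_nonneg _)) zero_le_two
  have hM : ∀ x, ∑ l, fU x l ^ 2 = ∑ l, fA (rA x) l ^ 2 + ∑ l, fB (rB x) l ^ 2 := fun x => by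
    have h1 := sum_subtype_of_support A (fun u => (if u ∈ A then υ u else 0) * x u ^ 2)
      fun u hu => by by_contra h; simp [h] at hu
    have h2 := sum_subtype_of_support B (fun u => (if u ∈ B then υ' u else 0) * x u ^ 2)
      fun u hu => by by_contra h; simp [h] at hu
    simp only [Subtype.prop, if_true] at h1 h2
    rw [hUM, hAM, hBM, hτ]
    refine Eq.trans ?_ (congrArg₂ (· + ·) h1 h2).symm
    simp only [add_mul, Finset.sum_add_distrib]
  have hQA : ∀ x, ∑ l, lam l * fA (rA x) l ^ 2 = ∑ u, ∑ v, ε u v * (x u - x v) ^ 2 / 2 :=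
    fun x => (hAQ _).trans (sum_sum_subtype_of_support A ε hεA x)
  have hQB : ∀ x, ∑ l, eta l * fB (rB x) l ^ 2 = ∑ u, ∑ v, ε' u v * (x u - x v) ^ 2 / 2 :=
    fun x => (hBQ _).trans (sum_sum_subtype_of_support B ε' hε'B x)
  have hQ : ∀ x, ∑ l, mu l * fU x l ^ 2
      = ∑ l, lam l * fA (rA x) l ^ 2 + ∑ l, eta l * fB (rB x) l ^ 2 := fun x => by
    rw [hUQ, hQA, hQB]
    simp only [← Finset.sum_add_distrib]
    exact Finset.sum_congr rfl fun u _ => Finset.sum_congr rfl fun v _ => by ring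
  have hMpos : ∀ x, x ≠ 0 → 0 < ∑ l, fU x l ^ 2 := fun x hx => by
    rw [hUM]
    obtain ⟨u, hu⟩ := Function.ne_iff.1 hx
    exact Finset.sum_pos' (fun v _ => mul_nonneg (hτpos v).le (sq_nonneg _))
      ⟨u, Finset.mem_univ u, mul_pos (hτpos u) (sq_pos_iff.2 hu)⟩
  have hMBnonneg : ∀ x, 0 ≤ ∑ l, fB (rB x) l ^ 2 := fun x =>
    Finset.sum_nonneg fun _ _ => sq_nonneg _
  refine ⟨fun i j hij => ?_, fun i j hij => ?_⟩
  · obtain ⟨ι, _, g, hι, hg⟩ := exists_coords_constant_on_components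
      (SimpleGraph.fromRel fun x y : {u // u ∈ B} => 0 < ε' x.1 y.1)
    rw [← hc, hcardB] at hι
    obtain ⟨x, hx0, h1, h2, h3⟩ := exists_ne_zero_of_card_lt
      (restrictCoords (fun l => i < l) ∘ₗ fA ∘ₗ rA) (restrictCoords (fun l => l < j) ∘ₗ fU)
      (g ∘ₗ rB) (by
        rw [Fintype.card_subtype, Fintype.card_subtype, hcardU]
        simp only [Finset.filter_lt_eq_Ioi, Finset.filter_gt_eq_Iio, Fin.card_Ioi,
          Fin.card_Iio]
        omega)
    have hB0 : ∑ l, eta l * fB (rB x) l ^ 2 = 0 := by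
      rw [hQB]
      refine Finset.sum_eq_zero fun u _ => Finset.sum_eq_zero fun v _ => ?_
      by_cases h0 : ε' u v = 0
      · simp [h0]
      by_cases huv : u = v
      · simp [huv]
      obtain ⟨hu, hv⟩ := hε'B u v h0
      have hadj : x u = x v := hg _ h3 ⟨u, hu⟩ ⟨v, hv⟩
        ⟨fun h => huv (congrArg Subtype.val h), Or.inl ((hnonneg' u v).lt_of_ne' h0)⟩
      simp [hadj]
    have hA' : ∑ l, lam l * fA (rA x) l ^ 2 ≤ lam i * ∑ l, fA (rA x) l ^ 2 :=
      sum_mul_sq_le fun l hl => hlamMono (not_lt.1 fun h => hl (restrictCoords_eq_zero h1 l h))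
    have hU' : mu j * ∑ l, fU x l ^ 2 ≤ ∑ l, mu l * fU x l ^ 2 :=
      le_sum_mul_sq fun l hl => hmuMono (not_lt.1 fun h => hl (restrictCoords_eq_zero h2 l h))
    refine le_of_mul_le_mul_right ?_ (hMpos x hx0)
    have := mul_nonneg (hlam0 i) (hMBnonneg x)
    rw [hQ, hB0] at hU'
    rw [hM] at hU' ⊢
    linarith
  · obtain ⟨x, hx0, h1, h2, h3⟩ := exists_ne_zero_of_card_lt
      (restrictCoords (fun l => l < i) ∘ₗ fA ∘ₗ rA) (restrictCoords (fun l => j < l) ∘ₗ fU)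
      (restrictCoords (fun l => ¬ lam ⟨n - 1, by omega⟩ ≤ eta l) ∘ₗ fB ∘ₗ rB) (by
        rw [Fintype.card_subtype_compl, Fintype.card_subtype, Fintype.card_subtype,
          Fintype.card_subtype, hcardU, ← hb]
        simp only [Finset.filter_lt_eq_Ioi, Finset.filter_gt_eq_Iio, Fin.card_Ioi,
          Fin.card_Iio, Fintype.card_fin]
        have : b ≤ s := hb ▸ (Finset.card_le_univ _).trans_eq (Fintype.card_fin s)
        omega)
    have hA' : lam i * ∑ l, fA (rA x) l ^ 2 ≤ ∑ l, lam l * fA (rA x) l ^ 2 :=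
      le_sum_mul_sq fun l hl => hlamMono (not_lt.1 fun h => hl (restrictCoords_eq_zero h1 l h))
    have hU' : ∑ l, mu l * fU x l ^ 2 ≤ mu j * ∑ l, fU x l ^ 2 :=
      sum_mul_sq_le fun l hl => hmuMono (not_lt.1 fun h => hl (restrictCoords_eq_zero h2 l h))
    have hB' : lam i * ∑ l, fB (rB x) l ^ 2 ≤ ∑ l, eta l * fB (rB x) l ^ 2 :=
      le_sum_mul_sq fun l hl =>
        (hlamMono (Fin.le_def.2 (Nat.le_sub_one_of_lt i.2))).trans
          (not_not.1 fun h => hl (restrictCoords_eq_zero h3 l h))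
    refine le_of_mul_le_mul_right ?_ (hMpos x hx0)
    rw [hQ] at hU'
    rw [hM] at hU' ⊢
    linarith
end
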